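/- Let G be a graph on n ≥ 1 vertices with Laplacian matrix L(G), let k ≥ 1 and p ≥ k, and let H = K_p ∘_k (G ∨ K_k) with Laplacian matrix L. Then L(G) + k·I_n is invertible, and for every matrix X with L·X·L = L, the quantity r(i,j) = X_{ii} + X_{jj} − X_{ij} − X_{ji} satisfies: (i) r(i,j) = 2/(p+n) for distinct i, j ∈ T; (ii) r(i,j) = (k(2p+n)+n)/(k·p·(p+n)) for i ∈ T, j ∈ A; (iii) r(i,j) = (k−1)/(k(p+n)) + ((L(G)+kI_n)⁻¹)_{jj} for i ∈ T, j ∈ V(G); (iv) r(i,j) = 2/p for distinct i, j ∈ A; (v) r(i,j) = (k+1)/(k·p) + ((L(G)+kI_n)⁻¹)_{jj} for i ∈ A, j ∈ V(G); (vi) r(i,j) = ((L(G)+kI_n)⁻¹)_{ii} + ((L(G)+kI_n)⁻¹)_{jj} − 2((L(G)+kI_n)⁻¹)_{ij} for distinct i, j ∈ V(G). -/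

import Mathlib

open Matrix

-- The Laplacian matrix `L = D − A` of a finite simple graph, over `ℝ`.
open Classical in
noncomputable def lapMat {V : Type} [Fintype V] (G : SimpleGraph V) : Matrix V V ℝ :=
  Matrix.of fun i j =>
    if i = j then (Nat.card {v // G.Adj i v} : ℝ)
    else if G.Adj i j then -1 else 0

/-- Vertex set of `K_p ∘ₖ (G ∨ K_k)`: the identified clique `T` (size `k`), the
remaining vertices `A` of `K_p` (size `a = p − k`), and the vertices of `G`. -/
abbrev JCV (k a n : ℕ) := Fin k ⊕ (Fin a ⊕ Fin n)

/-- The graph `K_p ∘ₖ (G ∨ K_k)` (with `a = p − k`): `T ∪ A` induces `K_p`, every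
vertex of `T` is adjacent to every vertex of `G`, the edges inside `V(G)` are the
edges of `G`, and there are no edges between `A` and `V(G)`. -/
def JoinCoal (k a : ℕ) {n : ℕ} (G : SimpleGraph (Fin n)) : SimpleGraph (JCV k a n) :=
  SimpleGraph.fromRel (fun u v =>
    match u, v with
    | Sum.inr (Sum.inl _), Sum.inr (Sum.inr _) => False
    | Sum.inr (Sum.inr _), Sum.inr (Sum.inl _) => False
    | Sum.inr (Sum.inr x), Sum.inr (Sum.inr y) => G.Adj x y
    | _, _ => True)

theorem lapMat_eq_lapMatrix {V : Type} [Fintype V] [DecidableEq V] (G : SimpleGraph V)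
    [DecidableRel G.Adj] : lapMat G = G.lapMatrix ℝ := by
  ext i j
  by_cases h : i = j
  · subst h
    have hd : Nat.card {v // G.Adj i v} = G.degree i := by
      rw [← SimpleGraph.card_neighborSet_eq_degree, ← Nat.card_eq_fintype_card]
      rfl
    simp [lapMat, SimpleGraph.lapMatrix, SimpleGraph.degMatrix, -Nat.card_eq_fintype_card, hd]
  · by_cases hG : G.Adj i j <;>
      simp [lapMat, SimpleGraph.lapMatrix, SimpleGraph.degMatrix, h, hG]

theorem lapMat_transpose {V : Type} [Fintype V] (G : SimpleGraph V) :
    (lapMat G)ᵀ = lapMat G := by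
  classical
  rw [lapMat_eq_lapMatrix]
  exact G.isSymm_lapMatrix ℝ

open Classical in
theorem lapMat_mulVec_apply {V : Type} [Fintype V] (G : SimpleGraph V) (v : V → ℝ) (x : V) :
    (lapMat G *ᵥ v) x = ∑ y, if G.Adj x y then v x - v y else 0 := by
  rw [lapMat_eq_lapMatrix, SimpleGraph.lapMatrix_mulVec_apply, ← Finset.sum_filter,
    Finset.sum_sub_distrib, ← SimpleGraph.neighborFinset_eq_filter]
  simp

theorem posDef_lapMat_add_smul_one {V : Type} [Fintype V] [DecidableEq V] (G : SimpleGraph V)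
    {c : ℝ} (hc : 0 < c) : (lapMat G + c • (1 : Matrix V V ℝ)).PosDef := by
  classical
  rw [lapMat_eq_lapMatrix]
  exact PosDef.posSemidef_add (G.posSemidef_lapMatrix ℝ) (PosDef.one.smul hc)

/-- The resistance distance between `i` and `j` is the potential difference created by a unit
current flowing from `i` to `j`. -/
theorem resistance_eq_of_potential {V : Type} [Fintype V] [DecidableEq V] {L X : Matrix V V ℝ}
    (hL : Lᵀ = L) (hX : L * X * L = L) {v : V → ℝ} {i j : V}
    (hv : L *ᵥ v = Pi.single i 1 - Pi.single j 1) :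
    X i i + X j j - X i j - X j i = v i - v j := by
  have hv' : v ᵥ* L = Pi.single i 1 - Pi.single j 1 := by
    rw [← hv, ← mulVec_transpose, hL]
  have h : v ⬝ᵥ ((L * X * L) *ᵥ v) = v ⬝ᵥ (L *ᵥ v) := by rw [hX]
  rw [← mulVec_mulVec, ← mulVec_mulVec, dotProduct_mulVec, hv', hv] at h
  simp [mulVec_sub, sub_dotProduct] at h
  linarith

section Inverse

variable {V : Type} [Fintype V] [DecidableEq V] (G : SimpleGraph V)

theorem inv_lapMat_add_smul_one_comm (c : ℝ) (i j : V) :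
    (lapMat G + c • (1 : Matrix V V ℝ))⁻¹ i j = (lapMat G + c • (1 : Matrix V V ℝ))⁻¹ j i := by
  have h : (lapMat G + c • (1 : Matrix V V ℝ))⁻¹ᵀ = (lapMat G + c • (1 : Matrix V V ℝ))⁻¹ := by
    rw [transpose_nonsing_inv]
    simp [lapMat_transpose]
  exact congr_fun (congr_fun h j) i

theorem lapMat_add_smul_one_mulVec_const (c d : ℝ) :
    (lapMat G + c • (1 : Matrix V V ℝ)) *ᵥ (fun _ => d) = fun _ => c * d := by
  ext x
  rw [add_mulVec, Pi.add_apply, lapMat_mulVec_apply]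
  simp [smul_mulVec]

theorem sum_lapMat_add_smul_one_mulVec (c : ℝ) (v : V → ℝ) :
    ∑ x, ((lapMat G + c • (1 : Matrix V V ℝ)) *ᵥ v) x = c * ∑ x, v x := by
  have hT : (lapMat G + c • (1 : Matrix V V ℝ))ᵀ = lapMat G + c • (1 : Matrix V V ℝ) := by
    simp [lapMat_transpose]
  have h := dotProduct_mulVec (fun _ : V => (1 : ℝ)) (lapMat G + c • (1 : Matrix V V ℝ)) v
  rw [← mulVec_transpose, hT, lapMat_add_smul_one_mulVec_const] at h
  simpa [dotProduct, Finset.mul_sum] using h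

theorem sum_inv_lapMat_add_smul_one_mulVec {c : ℝ} (hc : 0 < c) (v : V → ℝ) :
    ∑ x, ((lapMat G + c • (1 : Matrix V V ℝ))⁻¹ *ᵥ v) x = (∑ x, v x) / c := by
  rw [eq_div_iff hc.ne', mul_comm, ← sum_lapMat_add_smul_one_mulVec G, mulVec_mulVec,
    mul_nonsing_inv _
      ((isUnit_iff_isUnit_det _).1 (posDef_lapMat_add_smul_one G hc).isUnit), one_mulVec]

end Inverse

section JoinCoal

variable {k a n : ℕ} (G : SimpleGraph (Fin n)) (v : JCV k a n → ℝ)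

theorem lapMat_joinCoal_mulVec_inl (t : Fin k) :
    (lapMat (JoinCoal k a G) *ᵥ v) (Sum.inl t) =
      ((k : ℝ) + a + n) * v (Sum.inl t) - ∑ y, v y := by
  classical
  have h : ∀ y, (if (JoinCoal k a G).Adj (Sum.inl t) y then v (Sum.inl t) - v y else 0) =
      v (Sum.inl t) - v y := by
    intro y
    split_ifs with hy
    · rfl
    · have : Sum.inl t = y := by
        by_contra hne
        exact hy (by simp [JoinCoal, hne])
      rw [this, sub_self]
  rw [lapMat_mulVec_apply, Finset.sum_congr rfl fun y _ => h y]
  simp only [Finset.sum_sub_distrib, Finset.sum_const, Finset.card_univ, Fintype.card_sum,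
    Fintype.card_fin, nsmul_eq_mul]
  push_cast
  ring

theorem lapMat_joinCoal_mulVec_inr_inl (x : Fin a) :
    (lapMat (JoinCoal k a G) *ᵥ v) (Sum.inr (Sum.inl x)) =
      ((k : ℝ) + a) * v (Sum.inr (Sum.inl x)) - ∑ y, v (Sum.inl y)
        - ∑ y, v (Sum.inr (Sum.inl y)) := by
  classical
  have h : ∀ y, (if (JoinCoal k a G).Adj (Sum.inr (Sum.inl x)) (Sum.inr (Sum.inl y)) then
      v (Sum.inr (Sum.inl x)) - v (Sum.inr (Sum.inl y)) else 0) =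
      v (Sum.inr (Sum.inl x)) - v (Sum.inr (Sum.inl y)) := by
    intro y
    split_ifs with hy
    · rfl
    · have : x = y := by
        by_contra hne
        exact hy (by simp [JoinCoal, hne])
      rw [this, sub_self]
  rw [lapMat_mulVec_apply, Fintype.sum_sum_type, Fintype.sum_sum_type,
    Finset.sum_congr rfl fun y _ => h y]
  simp [JoinCoal]
  ring

theorem lapMat_joinCoal_mulVec_inr_inr (x : Fin n) :
    (lapMat (JoinCoal k a G) *ᵥ v) (Sum.inr (Sum.inr x)) =
      ((lapMat G + (k : ℝ) • (1 : Matrix (Fin n) (Fin n) ℝ)) *ᵥ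
        fun y => v (Sum.inr (Sum.inr y))) x - ∑ y, v (Sum.inl y) := by
  classical
  have h : ∀ y, (JoinCoal k a G).Adj (Sum.inr (Sum.inr x)) (Sum.inr (Sum.inr y)) ↔
      G.Adj x y := by
    intro y
    simp only [JoinCoal, SimpleGraph.fromRel_adj, G.adj_comm y x, or_self]
    exact ⟨fun hy => hy.2, fun hy => ⟨by simpa using hy.ne, hy⟩⟩
  rw [lapMat_mulVec_apply, Fintype.sum_sum_type, Fintype.sum_sum_type, add_mulVec, Pi.add_apply,
    lapMat_mulVec_apply]
  simp only [h]
  simp [JoinCoal, smul_mulVec]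
  ring

/-- The potential on `K_p ∘ₖ (G ∨ K_k)` created by injecting currents `wT`, `wA` and `wG` into
the identified vertices, the remaining vertices of `K_p`, and the vertices of `G`. -/
noncomputable def joinCoalPotential (wT : Fin k → ℝ) (wA : Fin a → ℝ) (wG : Fin n → ℝ) :
    JCV k a n → ℝ :=
  let s := (∑ t, wT t) / ((k : ℝ) + a + n)
  Sum.elim (fun t => wT t / ((k : ℝ) + a + n))
    (Sum.elim (fun x => wA x / ((k : ℝ) + a) + (s + (∑ y, wA y) / ((k : ℝ) + a)) / k)
      (fun x => ((lapMat G + (k : ℝ) • (1 : Matrix (Fin n) (Fin n) ℝ))⁻¹ *ᵥ wG) x + s / k))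

variable {G} in
theorem lapMat_mulVec_joinCoalPotential (hk : 1 ≤ k) {wT : Fin k → ℝ} {wA : Fin a → ℝ}
    {wG : Fin n → ℝ} (hw : ∑ t, wT t + ∑ x, wA x + ∑ x, wG x = 0) :
    lapMat (JoinCoal k a G) *ᵥ joinCoalPotential G wT wA wG =
      Sum.elim wT (Sum.elim wA wG) := by
  have hk0 : (0 : ℝ) < k := by exact_mod_cast hk
  have hka : (k : ℝ) + a ≠ 0 := by positivity
  have hkan : (k : ℝ) + a + n ≠ 0 := by positivity
  ext (t | x | x)
  · have hsum : ∑ y, joinCoalPotential G wT wA wG y = 0 := by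
      simp only [joinCoalPotential, Fintype.sum_sum_type, Sum.elim_inl, Sum.elim_inr,
        Finset.sum_add_distrib, ← Finset.sum_div, sum_inv_lapMat_add_smul_one_mulVec G hk0]
      simp only [Finset.sum_const, Finset.card_univ, Fintype.card_fin, nsmul_eq_mul]
      rw [eq_neg_of_add_eq_zero_right hw]
      field_simp
      ring
    rw [lapMat_joinCoal_mulVec_inl, hsum]
    simp only [joinCoalPotential, Sum.elim_inl]
    field_simp
    ring
  · rw [lapMat_joinCoal_mulVec_inr_inl]
    simp only [joinCoalPotential, Sum.elim_inl, Sum.elim_inr, Finset.sum_add_distrib,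
      ← Finset.sum_div, Finset.sum_const, Finset.card_univ, Fintype.card_fin, nsmul_eq_mul]
    field_simp
    ring
  · rw [lapMat_joinCoal_mulVec_inr_inr]
    simp only [joinCoalPotential, Sum.elim_inl, Sum.elim_inr, ← Finset.sum_div]
    change (_ *ᵥ (_ *ᵥ wG + fun _ => _)) x - _ = _
    rw [mulVec_add, mulVec_mulVec, mul_nonsing_inv _
      ((isUnit_iff_isUnit_det _).1 (posDef_lapMat_add_smul_one G hk0).isUnit), one_mulVec,
      lapMat_add_smul_one_mulVec_const, Pi.add_apply]
    field_simp
    ring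

/-- In `K_p ∘ₖ (G ∨ K_k)`, the resistance distance is read off from the potential of a unit
current. -/
theorem resistance_joinCoal_eq_potential (hk : 1 ≤ k)
    {X : Matrix (JCV k a n) (JCV k a n) ℝ}
    (hX : lapMat (JoinCoal k a G) * X * lapMat (JoinCoal k a G) = lapMat (JoinCoal k a G))
    (i j : JCV k a n) {w : JCV k a n → ℝ} (hw : w = Pi.single i 1 - Pi.single j 1) :
    X i i + X j j - X i j - X j i =
      joinCoalPotential G (fun t => w (Sum.inl t)) (fun x => w (Sum.inr (Sum.inl x)))
          (fun x => w (Sum.inr (Sum.inr x))) i -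
        joinCoalPotential G (fun t => w (Sum.inl t)) (fun x => w (Sum.inr (Sum.inl x)))
          (fun x => w (Sum.inr (Sum.inr x))) j := by
  refine resistance_eq_of_potential (lapMat_transpose _) hX ?_
  rw [lapMat_mulVec_joinCoalPotential hk, ← hw]
  · ext (t | x | x) <;> rfl
  · have h : ∑ y, w y = 0 := by
      simp [hw]
    rw [← h, Fintype.sum_sum_type, Fintype.sum_sum_type, add_assoc]

end JoinCoal

/-- Resistance distances in `K_p ∘ₖ (G ∨ K_k)` for a graph `G` on `n ≥ 1` vertices,
`k ≥ 1`, `p ≥ k`: the matrix `L(G) + k·Iₙ` is invertible, and the six case formulas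
for the resistance distance hold. -/
theorem resistance_joinCoal (n k p : ℕ) (hn : 1 ≤ n) (hk : 1 ≤ k) (hp : k ≤ p)
    (G : SimpleGraph (Fin n)) :
    IsUnit (lapMat G + (k : ℝ) • (1 : Matrix (Fin n) (Fin n) ℝ)) ∧
    ∀ X : Matrix (JCV k (p - k) n) (JCV k (p - k) n) ℝ,
      lapMat (JoinCoal k (p - k) G) * X * lapMat (JoinCoal k (p - k) G)
        = lapMat (JoinCoal k (p - k) G) →
      -- (i) distinct identified vertices
      (∀ i j : Fin k, i ≠ j →
        X (Sum.inl i) (Sum.inl i) + X (Sum.inl j) (Sum.inl j)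
          - X (Sum.inl i) (Sum.inl j) - X (Sum.inl j) (Sum.inl i)
          = 2 / ((p : ℝ) + (n : ℝ))) ∧
      -- (ii) identified vertex and a vertex of A
      (∀ (i : Fin k) (j : Fin (p - k)),
        X (Sum.inl i) (Sum.inl i)
          + X (Sum.inr (Sum.inl j)) (Sum.inr (Sum.inl j))
          - X (Sum.inl i) (Sum.inr (Sum.inl j))
          - X (Sum.inr (Sum.inl j)) (Sum.inl i)
          = ((k : ℝ) * (2 * (p : ℝ) + (n : ℝ)) + (n : ℝ))
              / ((k : ℝ) * (p : ℝ) * ((p : ℝ) + (n : ℝ)))) ∧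
      -- (iii) identified vertex and a vertex of G
      (∀ (i : Fin k) (j : Fin n),
        X (Sum.inl i) (Sum.inl i)
          + X (Sum.inr (Sum.inr j)) (Sum.inr (Sum.inr j))
          - X (Sum.inl i) (Sum.inr (Sum.inr j))
          - X (Sum.inr (Sum.inr j)) (Sum.inl i)
          = ((k : ℝ) - 1) / ((k : ℝ) * ((p : ℝ) + (n : ℝ)))
            + (lapMat G + (k : ℝ) • (1 : Matrix (Fin n) (Fin n) ℝ))⁻¹ j j) ∧
      -- (iv) distinct vertices of A
      (∀ i j : Fin (p - k), i ≠ j →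
        X (Sum.inr (Sum.inl i)) (Sum.inr (Sum.inl i))
          + X (Sum.inr (Sum.inl j)) (Sum.inr (Sum.inl j))
          - X (Sum.inr (Sum.inl i)) (Sum.inr (Sum.inl j))
          - X (Sum.inr (Sum.inl j)) (Sum.inr (Sum.inl i)) = 2 / (p : ℝ)) ∧
      -- (v) a vertex of A and a vertex of G
      (∀ (i : Fin (p - k)) (j : Fin n),
        X (Sum.inr (Sum.inl i)) (Sum.inr (Sum.inl i))
          + X (Sum.inr (Sum.inr j)) (Sum.inr (Sum.inr j))
          - X (Sum.inr (Sum.inl i)) (Sum.inr (Sum.inr j))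
          - X (Sum.inr (Sum.inr j)) (Sum.inr (Sum.inl i))
          = ((k : ℝ) + 1) / ((k : ℝ) * (p : ℝ))
            + (lapMat G + (k : ℝ) • (1 : Matrix (Fin n) (Fin n) ℝ))⁻¹ j j) ∧
      -- (vi) distinct vertices of G
      (∀ i j : Fin n, i ≠ j →
        X (Sum.inr (Sum.inr i)) (Sum.inr (Sum.inr i))
          + X (Sum.inr (Sum.inr j)) (Sum.inr (Sum.inr j))
          - X (Sum.inr (Sum.inr i)) (Sum.inr (Sum.inr j))
          - X (Sum.inr (Sum.inr j)) (Sum.inr (Sum.inr i))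
          = (lapMat G + (k : ℝ) • (1 : Matrix (Fin n) (Fin n) ℝ))⁻¹ i i
            + (lapMat G + (k : ℝ) • (1 : Matrix (Fin n) (Fin n) ℝ))⁻¹ j j
            - 2 * (lapMat G + (k : ℝ) • (1 : Matrix (Fin n) (Fin n) ℝ))⁻¹ i j) := by
  have hk0 : (0 : ℝ) < k := by exact_mod_cast hk
  refine ⟨(posDef_lapMat_add_smul_one G hk0).isUnit, fun X hX => ?_⟩
  obtain ⟨a, rfl⟩ := Nat.exists_eq_add_of_le hp
  generalize hb : k + a - k = b at X hX ⊢
  obtain rfl : b = a := by omega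
  have hka : (k : ℝ) + b ≠ 0 := by positivity
  have hkan : (k : ℝ) + b + n ≠ 0 := by positivity
  push_cast
  refine ⟨fun i j hij => ?_, fun i j => ?_, fun i j => ?_, fun i j hij => ?_, fun i j => ?_,
    fun i j hij => ?_⟩
  · rw [resistance_joinCoal_eq_potential G hk hX _ _ rfl]
    simp [joinCoalPotential, Pi.single_apply, hij, hij.symm]
    ring
  · rw [resistance_joinCoal_eq_potential G hk hX _ _ rfl]
    simp [joinCoalPotential, Pi.single_apply]
    field_simp
    ring
  · rw [resistance_joinCoal_eq_potential G hk hX _ _ rfl]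
    simp [joinCoalPotential, Pi.single_apply, mulVec, dotProduct]
    field_simp
    ring
  · rw [resistance_joinCoal_eq_potential G hk hX _ _ rfl]
    simp [joinCoalPotential, Pi.single_apply, hij, hij.symm]
    ring
  · rw [resistance_joinCoal_eq_potential G hk hX _ _ rfl]
    simp [joinCoalPotential, Pi.single_apply, mulVec, dotProduct]
    field_simp
  · rw [resistance_joinCoal_eq_potential G hk hX _ _ rfl]
    simp [joinCoalPotential, Pi.single_apply, mulVec, dotProduct, mul_sub,
      Finset.sum_sub_distrib, inv_lapMat_add_smul_one_comm G (k : ℝ) j i]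
    ring
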